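/- arXiv:2604.20728 — 2 statements merged into one kernel-verified Lean document; each statement's English description precedes it below -/
import Mathlib

section
/- Let S, O, A be finite nonempty types, T a transition kernel, and Z⁻, Z⁺ interval bounds with admissible set 𝒵. Fix a history h = ((a_0,o_1),…,(a_{t-1},o_t)) ∈ (A × O)^t, an initial belief b₀ ∈ Δ(S), a predicate safe : S → Prop (the set of states in which a given action is admitted by the perfect-perception shield), and β ∈ ℝ. Suppose B̂ : ℕ → Set (S → ℝ) satisfies: b₀ ∈ B̂ 0, and for every i < t, every belief b ∈ B̂ i ∩ Δ(S), and every Z ∈ 𝒵, if the evidence mass N(b, a_i, o_{i+1}, Z) is positive then the Bayes update of b belongs to B̂ (i+1). Suppose moreover that ∑_{s : safe s} b s ≥ β for every b ∈ B̂ t ∩ Δ(S). Then for every choice of kernels Z_1, …, Z_t ∈ 𝒵 for which all evidence masses along h are positive, the posterior belief b_t satisfies ∑_{s : safe s} b_t s ≥ β; in particular this holds for the fixed-kernel posterior b_t^Z for every Z ∈ 𝒵. -/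
open Finset

/-- A belief over a finite state space: pointwise nonnegative and summing to one. -/
def IsBelief {S : Type*} [Fintype S] (b : S → ℝ) : Prop :=
  (∀ s, 0 ≤ b s) ∧ ∑ s, b s = 1

/-- The evidence mass `N(b, a, o, Z)` of a belief `b` under action `a`,
observation `o`, transition kernel `T`, and emission kernel `Z`. -/
def evidence {S A O : Type*} [Fintype S] (T : A → S → S → ℝ) (Z : S → O → ℝ)
    (b : S → ℝ) (a : A) (o : O) : ℝ :=
  ∑ s', Z s' o * ∑ s, T a s s' * b s

/-- The Bayes update of a belief `b` after action `a` and observation `o`. -/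
noncomputable def bayesUpdate {S A O : Type*} [Fintype S] (T : A → S → S → ℝ) (Z : S → O → ℝ)
    (b : S → ℝ) (a : A) (o : O) : S → ℝ :=
  fun s' => Z s' o * (∑ s, T a s s' * b s) / evidence T Z b a o

theorem IsBelief.bayesUpdate {S A O : Type*} [Fintype S] {T : A → S → S → ℝ}
    {Z : S → O → ℝ} {b : S → ℝ} {a : A} {o : O} (hb : IsBelief b)
    (hT : ∀ s s', 0 ≤ T a s s') (hZ : ∀ s, 0 ≤ Z s o) (hpos : 0 < evidence T Z b a o) :
    IsBelief (bayesUpdate T Z b a o) := by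
  refine ⟨fun s' => div_nonneg (mul_nonneg (hZ s') ?_) hpos.le, ?_⟩
  · exact Finset.sum_nonneg fun s _ => mul_nonneg (hT s s') (hb.1 s)
  · simp only [_root_.bayesUpdate, ← Finset.sum_div]
    exact div_self hpos.ne'

/-- Theorem V.1 (Abstraction Soundness): if every belief in the envelope at
time `t` assigns mass at least `β` to the safe states, then every posterior
belief reachable along the history under per-step-varying admissible kernels
(and in particular the fixed-kernel posterior for each `Z ∈ 𝒵`) assigns mass
at least `β` to the safe states. -/
theorem abstraction_soundness
    {S O A : Type*} [Fintype S] [Nonempty S] [Fintype O] [Nonempty O]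
    [Fintype A] [Nonempty A]
    (T : A → S → S → ℝ)
    (hT : ∀ a s, (∀ s', 0 ≤ T a s s') ∧ ∑ s', T a s s' = 1)
    (Zlo Zhi : S → O → ℝ)
    (hZlo : ∀ s o, 0 ≤ Zlo s o) (hZhi : ∀ s o, Zhi s o ≤ 1)
    (𝒵 : Set (S → O → ℝ))
    (h𝒵 : 𝒵 = {Z | (∀ s o, Zlo s o ≤ Z s o ∧ Z s o ≤ Zhi s o) ∧ ∀ s, ∑ o, Z s o = 1})
    -- the history h = ((a_0, o_1), …, (a_{t-1}, o_t)):
    (t : ℕ) (act : Fin t → A) (obs : Fin t → O)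
    (b₀ : S → ℝ) (hb₀ : IsBelief b₀)
    -- the perfect-perception shield's admitted-state predicate and threshold:
    (safe : S → Prop) [DecidablePred safe] (β : ℝ)
    (Bhat : ℕ → Set (S → ℝ))
    (hInit : b₀ ∈ Bhat 0)
    (hStep : ∀ i : Fin t, ∀ b ∈ Bhat i, IsBelief b → ∀ Z ∈ 𝒵,
      0 < evidence T Z b (act i) (obs i) →
      bayesUpdate T Z b (act i) (obs i) ∈ Bhat ((i : ℕ) + 1))
    -- every belief in the time-t envelope has safety score at least β:
    (hSafeScore : ∀ b ∈ Bhat t, IsBelief b →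
      β ≤ ∑ s ∈ Finset.univ.filter safe, b s)
    -- per-step kernels Z_1, …, Z_t from the admissible set:
    (Zs : Fin t → (S → O → ℝ)) (hZs : ∀ i, Zs i ∈ 𝒵)
    -- the resulting posterior belief sequence b_0 = b₀, b_1, …, b_t:
    (bseq : ℕ → (S → ℝ))
    (hb0 : bseq 0 = b₀)
    (hpos : ∀ i : Fin t, 0 < evidence T (Zs i) (bseq i) (act i) (obs i))
    (hrec : ∀ i : Fin t,
      bseq ((i : ℕ) + 1) = bayesUpdate T (Zs i) (bseq i) (act i) (obs i)) :
    β ≤ ∑ s ∈ Finset.univ.filter safe, bseq t s := by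
  subst h𝒵
  have posterior_mem : ∀ i ≤ t, bseq i ∈ Bhat i ∧ IsBelief (bseq i) := by
    intro i
    induction i with
    | zero => exact fun _ => hb0 ▸ ⟨hInit, hb₀⟩
    | succ i ih =>
      intro hi
      obtain ⟨hmem, hbel⟩ := ih (by omega)
      rw [hrec ⟨i, hi⟩]
      exact ⟨hStep ⟨i, hi⟩ _ hmem hbel _ (hZs _) (hpos _),
        hbel.bayesUpdate (fun s => (hT _ s).1)
          (fun s => (hZlo s _).trans ((hZs _).1 s _).1) (hpos ⟨i, hi⟩)⟩
  exact hSafeScore _ (posterior_mem t le_rfl).1 (posterior_mem t le_rfl).2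
end

section
/- Let S be a finite nonempty type. Let P ⊆ (S → ℝ) be any set (the prior constraint set), T : S → S → ℝ, and y⁻, y⁺, Z⁻, Z⁺ : S → ℝ. Suppose b ∈ P ∩ Δ(S); let y s' = ∑_s T s s' · b s and assume y⁻ s' ≤ y s' ≤ y⁺ s' for all s'; let w : S → ℝ with Z⁻ s ≤ w s ≤ Z⁺ s for all s; let u s = y s · w s and assume ∑_s u s > 0; and let b' s = u s / ∑_j u j. Then b' belongs to the normalized relaxed reachable set N(P) := { u'/(∑_j u'_j) | there exist b̃ ∈ P ∩ Δ(S), ỹ, w̃, u' : S → ℝ such that ỹ s' = ∑_s T s s' · b̃ s for all s', y⁻ ≤ ỹ ≤ y⁺ pointwise, Z⁻ ≤ w̃ ≤ Z⁺ pointwise, ∑_j u'_j > 0, and for every s the four McCormick inequalities hold for (u' s, ỹ s, w̃ s) with box bounds (y⁻ s, y⁺ s, Z⁻ s, Z⁺ s): u' s ≥ Z⁻ s · ỹ s + y⁻ s · w̃ s − y⁻ s · Z⁻ s, u' s ≥ Z⁺ s · ỹ s + y⁺ s · w̃ s − y⁺ s · Z⁺ s, u' s ≤ Z⁻ s · ỹ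 s + y⁺ s · w̃ s − y⁺ s · Z⁻ s, u' s ≤ Z⁺ s · ỹ s + y⁻ s · w̃ s − y⁻ s · Z⁺ s }. -/
open Finset

/-- Soundness of the McCormick-relaxed LP step: every exact one-step Bayes
posterior reachable from the prior constraint set `P` under admissible
interval emission probabilities lies in the normalized relaxed reachable set
`N(P)` defined by the McCormick inequalities. -/
theorem mccormick_relaxation_sound
    {S : Type*} [Fintype S] [Nonempty S]
    (P : Set (S → ℝ)) (T : S → S → ℝ) (ylo yhi Zlo Zhi : S → ℝ)
    (b : S → ℝ) (hbP : b ∈ P) (hbΔ : IsBelief b)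
    (y : S → ℝ) (hy : ∀ s', y s' = ∑ s, T s s' * b s)
    (hylo : ∀ s', ylo s' ≤ y s') (hyhi : ∀ s', y s' ≤ yhi s')
    (w : S → ℝ) (hw : ∀ s, Zlo s ≤ w s ∧ w s ≤ Zhi s)
    (u : S → ℝ) (hu : ∀ s, u s = y s * w s)
    (hupos : 0 < ∑ s, u s)
    (b' : S → ℝ) (hb' : ∀ s, b' s = u s / ∑ j, u j) :
    b' ∈ {v : S → ℝ | ∃ bt yt wt u' : S → ℝ,
      bt ∈ P ∧ IsBelief bt ∧
      (∀ s', yt s' = ∑ s, T s s' * bt s) ∧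
      (∀ s, ylo s ≤ yt s ∧ yt s ≤ yhi s) ∧
      (∀ s, Zlo s ≤ wt s ∧ wt s ≤ Zhi s) ∧
      0 < ∑ j, u' j ∧
      (∀ s, Zlo s * yt s + ylo s * wt s - ylo s * Zlo s ≤ u' s ∧
            Zhi s * yt s + yhi s * wt s - yhi s * Zhi s ≤ u' s ∧
            u' s ≤ Zlo s * yt s + yhi s * wt s - yhi s * Zlo s ∧
            u' s ≤ Zhi s * yt s + ylo s * wt s - ylo s * Zhi s) ∧
      v = fun s => u' s / ∑ j, u' j} := by
  refine ⟨b, y, w, u, hbP, hbΔ, hy, fun s => ⟨hylo s, hyhi s⟩, hw, hupos, fun s => ?_, funext hb'⟩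
  have hyl := sub_nonneg.2 (hylo s)
  have hyu := sub_nonneg.2 (hyhi s)
  have hwl := sub_nonneg.2 (hw s).1
  have hwu := sub_nonneg.2 (hw s).2
  rw [hu s]
  refine ⟨?_, ?_, ?_, ?_⟩
  · linarith [mul_nonneg hyl hwl]
  · linarith [mul_nonneg hyu hwu]
  · linarith [mul_nonneg hyu hwl]
  · linarith [mul_nonneg hyl hwu]
end
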